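/- arXiv:2204.05429 — 5 statements merged into one kernel-verified Lean document; each statement's English description precedes it below -/
import Mathlib

section
/- Let n ∈ ℕ, k ∈ {0,…,n}, Δ ≥ 0, and let x ∈ k𝔹₀ satisfy |x_i| ≤ Δ for every i ∈ {1,…,n}. If w ∈ x + Δ𝔹∞, then the set of projections of w into C := k𝔹₀ ∩ (x + Δ𝔹∞) coincides with the set of projections of w into k𝔹₀; that is, P(w) = proj(w | k𝔹₀). -/
open Finset

noncomputable section

/-- The `ℓ∞` ball of radius `Δ` centered at `x`: `x + Δ𝔹∞`. -/
def box (n : ℕ) (x : Fin n → ℝ) (Δ : ℝ) : Set (Fin n → ℝ) :=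
  {y | ∀ i, |y i - x i| ≤ Δ}

/-- The zero-norm ball `k𝔹₀`: vectors with at most `k` nonzero components. -/
def sparse (n k : ℕ) : Set (Fin n → ℝ) :=
  {y | (Finset.univ.filter (fun i => y i ≠ 0)).card ≤ k}

/-- The piece `A_S`: vectors supported in `S`. -/
def AS {n : ℕ} (S : Finset (Fin n)) : Set (Fin n → ℝ) :=
  {y | ∀ i, i ∉ S → y i = 0}

/-- Squared Euclidean distance. -/
def distSq {n : ℕ} (w y : Fin n → ℝ) : ℝ := ∑ i, (w i - y i) ^ 2

/-- The set of projections (closest points in the Euclidean norm) of `w` into `A`. -/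
def projSet {n : ℕ} (w : Fin n → ℝ) (A : Set (Fin n → ℝ)) : Set (Fin n → ℝ) :=
  {y | y ∈ A ∧ ∀ z ∈ A, distSq w y ≤ distSq w z}

/-- The vector that agrees with `w` on the support of `y` and vanishes elsewhere. -/
def restrictToSupport {n : ℕ} (w y : Fin n → ℝ) : Fin n → ℝ :=
  fun i => if y i = 0 then 0 else w i

theorem restrictToSupport_mem_sparse {n k : ℕ} (w : Fin n → ℝ) {y : Fin n → ℝ}
    (hy : y ∈ sparse n k) : restrictToSupport w y ∈ sparse n k := by
  refine le_trans (Finset.card_le_card fun i hi => ?_) hy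
  exact Finset.mem_filter.2
    ⟨Finset.mem_univ i, fun h => (Finset.mem_filter.1 hi).2 (if_pos h)⟩

theorem restrictToSupport_mem_box {n : ℕ} {Δ : ℝ} {x w : Fin n → ℝ}
    (hx : ∀ i, |x i| ≤ Δ) (hw : w ∈ box n x Δ) (y : Fin n → ℝ) :
    restrictToSupport w y ∈ box n x Δ := by
  intro i
  by_cases h : y i = 0
  · simpa [restrictToSupport, h] using hx i
  · simpa [restrictToSupport, h] using hw i

theorem sub_restrictToSupport_sq_le {n : ℕ} (w y : Fin n → ℝ) (i : Fin n) :
    (w i - restrictToSupport w y i) ^ 2 ≤ (w i - y i) ^ 2 := by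
  by_cases h : y i = 0
  · simp [restrictToSupport, h]
  · simpa [restrictToSupport, h] using sq_nonneg (w i - y i)

theorem distSq_restrictToSupport_le {n : ℕ} (w y : Fin n → ℝ) :
    distSq w (restrictToSupport w y) ≤ distSq w y :=
  Finset.sum_le_sum fun i _ => sub_restrictToSupport_sq_le w y i

theorem eq_restrictToSupport_of_distSq_le {n : ℕ} {w y : Fin n → ℝ}
    (h : distSq w y ≤ distSq w (restrictToSupport w y)) : y = restrictToSupport w y := by
  have heq := (Finset.sum_eq_sum_iff_of_le fun i _ => sub_restrictToSupport_sq_le w y i).1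
    (le_antisymm (distSq_restrictToSupport_le w y) h)
  funext i
  have hi := heq i (Finset.mem_univ i)
  by_cases h0 : y i = 0
  · simp [restrictToSupport, h0]
  · have hsq : (w i - y i) ^ 2 = 0 := by simpa [restrictToSupport, h0] using hi.symm
    have hsub := pow_eq_zero_iff two_ne_zero |>.1 hsq
    simpa [restrictToSupport, h0] using (sub_eq_zero.1 hsub).symm

/-- Lemma lem:proj1proj2: if all `|x i| ≤ Δ` and `w ∈ x + Δ𝔹∞`,
then `P(w) = proj(w | k𝔹₀)`. -/
theorem stmt1 (n k : ℕ) (hkn : k ≤ n) (Δ : ℝ) (hΔ : 0 ≤ Δ)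
    (x : Fin n → ℝ) (hx : x ∈ sparse n k) (hxsmall : ∀ i, |x i| ≤ Δ)
    (w : Fin n → ℝ) (hw : w ∈ box n x Δ) :
    projSet w (sparse n k ∩ box n x Δ) = projSet w (sparse n k) := by
  ext y
  constructor
  · rintro ⟨⟨hy, -⟩, hmin⟩
    exact ⟨hy, fun z hz => (hmin _ ⟨restrictToSupport_mem_sparse w hz,
      restrictToSupport_mem_box hxsmall hw z⟩).trans (distSq_restrictToSupport_le w z)⟩
  · rintro ⟨hy, hmin⟩
    have hbox : y ∈ box n x Δ := by
      rw [eq_restrictToSupport_of_distSq_le (hmin _ (restrictToSupport_mem_sparse w hy))]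
      exact restrictToSupport_mem_box hxsmall hw y
    exact ⟨⟨hy, hbox⟩, fun z hz => hmin z hz.1⟩
end
end

section
/- Let n ∈ ℕ, Δ > 0, and let x ∈ ℝⁿ have exactly k nonzero components with 0 < k < n. Then k𝔹₀ ∩ (x + Δ𝔹∞) = A_{supp(x)} ∩ (x + Δ𝔹∞) if and only if |x_i| > Δ for every i ∈ supp(x). -/
open Finset

noncomputable section

/-- Lemma lem:suppx: for `Δ > 0` and `x` with exactly `k` nonzeros, `0 < k < n`,
`k𝔹₀ ∩ (x + Δ𝔹∞) = A_{supp x} ∩ (x + Δ𝔹∞)` iff `|x i| > Δ` for all `i ∈ supp x`. -/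
theorem stmt2 (n k : ℕ) (Δ : ℝ) (hΔ : 0 < Δ) (x : Fin n → ℝ)
    (hcard : (Finset.univ.filter (fun i => x i ≠ 0)).card = k)
    (hk0 : 0 < k) (hkn : k < n) :
    sparse n k ∩ box n x Δ =
        AS (Finset.univ.filter (fun i => x i ≠ 0)) ∩ box n x Δ ↔
      ∀ i, x i ≠ 0 → Δ < |x i| := by
  constructor
  · intro h i hi
    by_contra! hle
    obtain ⟨j, hj⟩ : ∃ j, x j = 0 := by
      by_contra! hall
      rw [Finset.filter_true_of_mem fun i _ => hall i, Finset.card_univ, Fintype.card_fin] at hcard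
      omega
    have hij : i ≠ j := fun e => hi (e ▸ hj)
    -- Moving one nonzero entry from `i` to `j` stays in the left-hand side but leaves `A_{supp x}`.
    let y : Fin n → ℝ := Function.update (Function.update x i 0) j Δ
    have hyj : y j = Δ := by simp [y]
    have hyi : y i = 0 := by simp [y, hij]
    have hy : ∀ l, l ≠ i → l ≠ j → y l = x l := fun l h1 h2 => by simp [y, h1, h2]
    have hmem : y ∈ sparse n k ∩ box n x Δ := by
      refine ⟨?_, fun l => ?_⟩
      · have hsub : Finset.univ.filter (fun l => y l ≠ 0) ⊆
            insert j ((Finset.univ.filter (fun l => x l ≠ 0)).erase i) := by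
          intro l hl
          simp only [Finset.mem_filter, Finset.mem_univ, true_and, Finset.mem_insert,
            Finset.mem_erase] at hl ⊢
          by_cases hlj : l = j
          · exact Or.inl hlj
          · have hli : l ≠ i := fun e => hl (e ▸ hyi)
            exact Or.inr ⟨hli, hy l hli hlj ▸ hl⟩
        have hc := (Finset.card_le_card hsub).trans (Finset.card_insert_le _ _)
        rw [Finset.card_erase_of_mem (by simpa using hi), hcard] at hc
        change (Finset.univ.filter (fun l => y l ≠ 0)).card ≤ k
        omega
      · by_cases hlj : l = j
        · rw [hlj, hyj, hj, sub_zero, abs_of_pos hΔ]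
        · by_cases hli : l = i
          · rwa [hli, hyi, zero_sub, abs_neg]
          · rw [hy l hli hlj, sub_self, abs_zero]
            exact hΔ.le
    rw [h] at hmem
    exact hΔ.ne' (hyj ▸ hmem.1 j (by simp [hj]))
  · intro h
    ext y
    refine and_congr_left fun hb => ⟨fun hs i hi => ?_, fun hA => ?_⟩
    · have hsub : Finset.univ.filter (fun l => x l ≠ 0) ⊆
          Finset.univ.filter (fun l => y l ≠ 0) := by
        intro l hl
        simp only [Finset.mem_filter, Finset.mem_univ, true_and] at hl ⊢
        intro h0
        have hbl := hb l
        rw [h0, zero_sub, abs_neg] at hbl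
        exact (h l hl).not_ge hbl
      have heq := Finset.eq_of_subset_of_card_le hsub (hcard ▸ hs)
      rw [heq] at hi
      simpa using hi
    · change (Finset.univ.filter (fun l => y l ≠ 0)).card ≤ k
      rw [← hcard]
      refine Finset.card_le_card fun l hl => ?_
      by_contra hn
      exact (Finset.mem_filter.1 hl).2 (hA l hn)
end
end

section
/- Let n ∈ ℕ, k ∈ {0,…,n}, Δ ≥ 0, x ∈ k𝔹₀, and set C := k𝔹₀ ∩ (x + Δ𝔹∞). Let f : ℝⁿ → ℝ be differentiable with ∇f Lipschitz continuous with constant L_f, and let y* be a global minimizer of f over C. Then for any L > L_f, the set proj(y* − L⁻¹∇f(y*) | C) is the singleton {y*}; in particular, y* ∈ proj(y* − L⁻¹∇f(y*) | C), i.e., y* is L-stationary. -/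
open Finset

noncomputable section

theorem distSq_nonneg {n : ℕ} (w y : Fin n → ℝ) : 0 ≤ distSq w y :=
  Finset.sum_nonneg fun _ _ => sq_nonneg _

theorem eq_of_distSq_nonpos {n : ℕ} {w y : Fin n → ℝ} (h : distSq w y ≤ 0) : w = y := by
  have h0 : ∑ i, (w i - y i) ^ 2 = 0 := le_antisymm h (distSq_nonneg w y)
  rw [Finset.sum_eq_zero_iff_of_nonneg fun _ _ => sq_nonneg _] at h0
  funext i
  exact sub_eq_zero.mp (pow_eq_zero_iff two_ne_zero |>.mp (h0 i (Finset.mem_univ i)))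

/-- A linear functional on `ℝⁿ` is determined by its values on the standard basis. -/
theorem clm_apply_eq_sum {n : ℕ} (T : (Fin n → ℝ) →L[ℝ] ℝ) (d : Fin n → ℝ) :
    T d = ∑ i, T (Pi.single i 1) * d i := by
  conv_lhs => rw [pi_eq_sum_univ' d, map_sum]
  refine Finset.sum_congr rfl fun i _ => ?_
  rw [map_smul, smul_eq_mul, mul_comm]

/-- The descent lemma for a function with Lipschitz gradient. -/
theorem le_add_sum_add_distSq {n : ℕ} {f : (Fin n → ℝ) → ℝ} {g : (Fin n → ℝ) → (Fin n → ℝ)}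
    (hdiff : Differentiable ℝ f) (hgrad : ∀ y i, g y i = fderiv ℝ f y (Pi.single i 1))
    {K : ℝ}
    (hlip : ∀ y z : Fin n → ℝ, √(distSq (g y) (g z)) ≤ K * √(distSq y z))
    (y z : Fin n → ℝ) :
    f z ≤ f y + ∑ i, g y i * (z i - y i) + K / 2 * distSq z y := by
  set d : Fin n → ℝ := z - y with hd
  set D := distSq z y with hD
  set s := ∑ i, g y i * (z i - y i) with hs
  have hderiv (t : ℝ) : HasDerivAt (fun t : ℝ => f (y + t • d) - t * s - K / 2 * D * t ^ 2)
      (∑ i, g (y + t • d) i * d i - s - K * D * t) t := by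
    have hline : HasDerivAt (fun t : ℝ => y + t • d) d t := by
      simpa using ((hasDerivAt_id t).smul_const d).const_add y
    have hf := (hdiff (y + t • d)).hasFDerivAt.comp_hasDerivAt t hline
    rw [clm_apply_eq_sum] at hf
    simp only [← hgrad] at hf
    refine ((hf.sub ((hasDerivAt_id t).mul_const s)).sub
      ((hasDerivAt_pow 2 t).const_mul (K / 2 * D))).congr_deriv ?_
    norm_num
    ring
  have hbound (t : ℝ) (ht : 0 ≤ t) : ∑ i, g (y + t • d) i * d i - s - K * D * t ≤ 0 := by
    have hdist : distSq (y + t • d) y = t ^ 2 * D := by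
      simp [distSq, hD, hd, Finset.mul_sum, mul_pow]
    have hcs := Real.sum_mul_le_sqrt_mul_sqrt Finset.univ
      (fun i => g (y + t • d) i - g y i) d
    have hl := hlip (y + t • d) y
    rw [hdist, Real.sqrt_mul (sq_nonneg t), Real.sqrt_sq ht] at hl
    have hDD : √D * √D = D := Real.mul_self_sqrt (distSq_nonneg z y)
    have hmul := mul_le_mul_of_nonneg_right hl (Real.sqrt_nonneg D)
    have hsum : ∑ i, (g (y + t • d) i - g y i) * d i = ∑ i, g (y + t • d) i * d i - s := by
      simp [hs, hd, sub_mul]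
    have hcs' : ∑ i, g (y + t • d) i * d i - s ≤ √(distSq (g (y + t • d)) (g y)) * √D := by
      rw [← hsum]
      exact hcs
    have heq : K * (t * √D) * √D = K * D * t := by linear_combination K * t * hDD
    linarith
  have hanti := antitoneOn_of_deriv_nonpos (convex_Icc (0 : ℝ) 1)
    (fun t _ => (hderiv t).continuousAt.continuousWithinAt)
    (fun t _ => (hderiv t).differentiableAt.differentiableWithinAt)
    (fun t ht => by
      rw [interior_Icc] at ht
      rw [(hderiv t).deriv]
      exact hbound t ht.1.le)
  have h01 := hanti (Set.left_mem_Icc.mpr zero_le_one) (Set.right_mem_Icc.mpr zero_le_one)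
    zero_le_one
  simp [hd] at h01
  linarith

theorem distSq_sub_smul {n : ℕ} (y v z : Fin n → ℝ) (c : ℝ) :
    distSq (fun i => y i - c * v i) z =
      distSq (fun i => y i - c * v i) y + distSq z y + 2 * c * ∑ i, v i * (z i - y i) := by
  simp only [distSq, Finset.mul_sum, ← Finset.sum_add_distrib]
  exact Finset.sum_congr rfl fun i _ => by ring

/-- Proposition prop:L-stat: if `∇f` is Lipschitz with constant `L_f`
(in the Euclidean norm) and `y*` is a global minimizer of `f` over
`C = k𝔹₀ ∩ (x + Δ𝔹∞)`, then for any `L > L_f` the set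
`proj(y* − L⁻¹∇f(y*) | C)` is the singleton `{y*}`; in particular `y*` is `L`-stationary. -/
theorem stmt6 (n k : ℕ) (hkn : k ≤ n) (Δ : ℝ) (hΔ : 0 ≤ Δ)
    (x : Fin n → ℝ) (hx : x ∈ sparse n k)
    (f : (Fin n → ℝ) → ℝ) (g : (Fin n → ℝ) → (Fin n → ℝ))
    (hdiff : Differentiable ℝ f)
    (hgrad : ∀ y i, g y i = fderiv ℝ f y (Pi.single i 1))
    (Lf : ℝ) (hLf : 0 ≤ Lf)
    (hlip : ∀ y z : Fin n → ℝ,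
      Real.sqrt (distSq (g y) (g z)) ≤ Lf * Real.sqrt (distSq y z))
    (ystar : Fin n → ℝ)
    (hmem : ystar ∈ sparse n k ∩ box n x Δ)
    (hmin : ∀ y ∈ sparse n k ∩ box n x Δ, f ystar ≤ f y)
    (L : ℝ) (hL : Lf < L) :
    projSet (fun i => ystar i - L⁻¹ * g ystar i) (sparse n k ∩ box n x Δ) =
      {ystar} := by
  have hL0 : 0 < L := hLf.trans_lt hL
  have hLinv : 0 < L⁻¹ := inv_pos.mpr hL0
  have hgap : 0 < 1 - L⁻¹ * Lf := by
    rw [sub_pos, inv_mul_lt_iff₀ hL0, mul_one]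
    exact hL
  have key (z : Fin n → ℝ) (hz : z ∈ sparse n k ∩ box n x Δ) :
      distSq (fun i => ystar i - L⁻¹ * g ystar i) ystar + (1 - L⁻¹ * Lf) * distSq z ystar ≤
        distSq (fun i => ystar i - L⁻¹ * g ystar i) z := by
    have hdesc := le_add_sum_add_distSq hdiff hgrad hlip ystar z
    have hsum : 0 ≤ ∑ i, g ystar i * (z i - ystar i) + Lf / 2 * distSq z ystar := by
      linarith [hmin z hz]
    rw [distSq_sub_smul ystar (g ystar) z]
    linarith [mul_nonneg hLinv.le hsum]
  refine Set.Subset.antisymm (fun z hz => ?_) (Set.singleton_subset_iff.mpr ⟨hmem, fun z hz => ?_⟩)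
  · have hle : (1 - L⁻¹ * Lf) * distSq z ystar ≤ 0 := by
      linarith [key z hz.1, hz.2 ystar hmem]
    exact eq_of_distSq_nonpos (nonpos_of_mul_nonpos_right hle hgap)
  · linarith [key z hz, mul_nonneg hgap.le (distSq_nonneg z ystar)]
end
end

section
/- Let n ∈ ℕ, k ∈ {0,…,n}, Δ ≥ 0, x ∈ k𝔹₀, w ∈ ℝⁿ, and set C := k𝔹₀ ∩ (x + Δ𝔹∞). If y* is a projection of w into C (a global minimizer of ‖w − y‖₂ over y ∈ C), then for any L > 1, proj(y* − L⁻¹(y* − w) | C) = {y*}. -/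
open Finset

noncomputable section

theorem distSq_self {n : ℕ} (w : Fin n → ℝ) : distSq w w = 0 := by
  simp [distSq]

/-- Stewart's identity for a point on the line through `y` and `w`. -/
theorem distSq_sub_mul {n : ℕ} (w y z : Fin n → ℝ) (t : ℝ) :
    distSq (fun i => y i - t * (y i - w i)) z =
      (1 - t) * distSq y z + t * distSq w z - t * (1 - t) * distSq w y := by
  simp only [distSq, Finset.mul_sum, ← Finset.sum_add_distrib, ← Finset.sum_sub_distrib]
  exact Finset.sum_congr rfl fun i _ => by ring

/-- Moving `w` strictly towards one of its projections `y` makes the projection unique. -/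
theorem projSet_sub_mul {n : ℕ} {A : Set (Fin n → ℝ)} {w y : Fin n → ℝ}
    (hy : y ∈ projSet w A) {t : ℝ} (ht₀ : 0 ≤ t) (ht₁ : t < 1) :
    projSet (fun i => y i - t * (y i - w i)) A = {y} := by
  have key : ∀ z ∈ A, distSq (fun i => y i - t * (y i - w i)) y + (1 - t) * distSq y z ≤
      distSq (fun i => y i - t * (y i - w i)) z := by
    intro z hz
    rw [distSq_sub_mul, distSq_sub_mul, distSq_self]
    linarith [mul_le_mul_of_nonneg_left (hy.2 z hz) ht₀]
  ext z
  rw [Set.mem_singleton_iff]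
  constructor
  · intro hz
    have hle : (1 - t) * distSq y z ≤ 0 := by linarith [key z hz.1, hz.2 y hy.1]
    exact (eq_of_distSq_nonpos (nonpos_of_mul_nonpos_right hle (sub_pos.mpr ht₁))).symm
  · rintro rfl
    refine ⟨hy.1, fun v hv => ?_⟩
    linarith [key v hv, mul_nonneg (sub_nonneg.mpr ht₁.le) (distSq_nonneg z v)]

/-- if `y*` is a projection of `w` into `C = k𝔹₀ ∩ (x + Δ𝔹∞)`, then for any
`L > 1`, `proj(y* − L⁻¹(y* − w) | C) = {y*}`. -/
theorem stmt7 (n k : ℕ) (hkn : k ≤ n) (Δ : ℝ) (hΔ : 0 ≤ Δ)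
    (x : Fin n → ℝ) (hx : x ∈ sparse n k)
    (w ystar : Fin n → ℝ)
    (hproj : ystar ∈ projSet w (sparse n k ∩ box n x Δ))
    (L : ℝ) (hL : 1 < L) :
    projSet (fun i => ystar i - L⁻¹ * (ystar i - w i))
        (sparse n k ∩ box n x Δ) = {ystar} := by
  exact projSet_sub_mul hproj (inv_nonneg.mpr (zero_le_one.trans hL.le)) (inv_lt_one_of_one_lt₀ hL)
end
end

section
/- Let n ∈ ℕ, Δ ≥ 0, x, w ∈ ℝⁿ, and let S ⊆ {1,…,n} satisfy |x_i| ≤ Δ for all i ∉ S. Let ŷ be the projection of w onto x + Δ𝔹∞, i.e., ŷ_i = max(x_i − Δ, min(w_i, x_i + Δ)) for all i, and set z_i := w_i² − (w_i − ŷ_i)². Then the unique projection y(S) of w onto A_S ∩ (x + Δ𝔹∞) is given by y(S)_i = ŷ_i for i ∈ S and y(S)_i = 0 for i ∉ S, and its squared distance to w satisfies ‖w − y(S)‖₂² = ‖w‖₂² − Σ_{i∈S} z_i. -/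
open Finset

noncomputable section

/-- Variational inequality for clamping to `[a - Δ, a + Δ]`. -/
theorem sq_sub_clamp_add_sq_le {a b c Δ : ℝ} (hΔ : 0 ≤ Δ) (hc : |c - a| ≤ Δ) :
    (b - max (a - Δ) (min b (a + Δ))) ^ 2 + (c - max (a - Δ) (min b (a + Δ))) ^ 2
      ≤ (b - c) ^ 2 := by
  obtain ⟨h₁, h₂⟩ := abs_le.mp hc
  rcases le_total b (a + Δ) with hb | hb
  · rw [min_eq_left hb]
    rcases le_total (a - Δ) b with hb' | hb'
    · rw [max_eq_right hb']
      nlinarith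
    · rw [max_eq_left hb']
      nlinarith [mul_nonneg (sub_nonneg.2 hb') (show 0 ≤ c - (a - Δ) by linarith)]
  · rw [min_eq_right hb, max_eq_right (by linarith)]
    nlinarith [mul_nonneg (sub_nonneg.2 hb) (show 0 ≤ a + Δ - c by linarith)]

theorem abs_clamp_sub_le {a b Δ : ℝ} (hΔ : 0 ≤ Δ) :
    |max (a - Δ) (min b (a + Δ)) - a| ≤ Δ := by
  have h₁ := le_max_left (a - Δ) (min b (a + Δ))
  have h₂ : max (a - Δ) (min b (a + Δ)) ≤ a + Δ :=
    max_le (by linarith) (min_le_right _ _)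
  exact abs_le.mpr ⟨by linarith, by linarith⟩

/-- A point of `A` satisfying the variational inequality is the unique projection. -/
theorem projSet_eq_singleton {n : ℕ} {w p : Fin n → ℝ} {A : Set (Fin n → ℝ)} (hp : p ∈ A)
    (h : ∀ y ∈ A, distSq w p + distSq y p ≤ distSq w y) : projSet w A = {p} := by
  refine Set.Subset.antisymm (fun y hy => ?_) (Set.singleton_subset_iff.mpr ?_)
  · exact eq_of_distSq_nonpos (by linarith [h y hy.1, hy.2 p hp])
  · exact ⟨hp, fun y hy => by linarith [h y hy, distSq_nonneg y p]⟩

/-- if `|x i| ≤ Δ` for all `i ∉ S`, the unique projection `y(S)` of `w` onto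
`A_S ∩ (x + Δ𝔹∞)` keeps the clamped values `ŷ_i` on `S` and is zero off `S`, and
`‖w − y(S)‖₂² = ‖w‖₂² − Σ_{i∈S} z_i` with `z_i = w_i² − (w_i − ŷ_i)²`. -/
theorem stmt9 (n : ℕ) (Δ : ℝ) (hΔ : 0 ≤ Δ) (x w : Fin n → ℝ)
    (S : Finset (Fin n)) (hS : ∀ i, i ∉ S → |x i| ≤ Δ)
    (yhat z yS : Fin n → ℝ)
    (hyhat : ∀ i, yhat i = max (x i - Δ) (min (w i) (x i + Δ)))
    (hz : ∀ i, z i = (w i) ^ 2 - (w i - yhat i) ^ 2)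
    (hyS : ∀ i, yS i = if i ∈ S then yhat i else 0) :
    projSet w (AS S ∩ box n x Δ) = {yS} ∧
    distSq w yS = (∑ i, (w i) ^ 2) - ∑ i ∈ S, z i := by
  refine ⟨projSet_eq_singleton ⟨fun i hi => by simp [hyS, hi], fun i => ?_⟩ ?_, ?_⟩
  · by_cases hi : i ∈ S
    · rw [hyS, if_pos hi, hyhat]
      exact abs_clamp_sub_le hΔ
    · simpa [hyS, hi] using hS i hi
  · rintro y ⟨hyA, hyB⟩
    unfold distSq
    rw [← Finset.sum_add_distrib]
    refine Finset.sum_le_sum fun i _ => ?_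
    by_cases hi : i ∈ S
    · rw [hyS, if_pos hi, hyhat]
      exact sq_sub_clamp_add_sq_le hΔ (hyB i)
    · simp [hyS, hi, hyA i hi]
  · have hsum : ∑ i ∈ S, z i = ∑ i, if i ∈ S then z i else 0 := by simp
    rw [hsum, ← Finset.sum_sub_distrib]
    refine Finset.sum_congr rfl fun i _ => ?_
    by_cases hi : i ∈ S <;> simp [hyS, hz, hi]
end
end
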